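/- arXiv:2411.02554 — 3 statements merged into one kernel-verified Lean document; each statement's English description precedes it below -/
import Mathlib

section
/- Let α be a type, K ≥ 1 a natural number, f : (Fin K → α) → Bool, and D a probability distribution on α. Suppose there is a constant c > 0 such that for every pair of tables w : Bool → (Fin K → α) and every real t > 0, Pr_{z ~ Uniform(Fin K → Bool)}[ s^z(g_w) ≥ t ] ≤ 2K · 2^{-t/c}. Then for every real p > 0: Pr_{x ~ D^K}[ p_f(x) ≥ p ] ≤ (4K/p) · 2^{-pK/(2c)}. -/
open scoped ENNReal
open Classical

/-- The block-resampling disagreement probability `p_f(x)`: a uniformly random coordinate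
`i : Fin K` is resampled from `D`, and we measure the probability that the value of `f`
changes. -/
noncomputable def resampleP {α : Type*} {K : ℕ} (D : PMF α) (f : (Fin K → α) → Bool)
    (x : Fin K → α) : ℝ≥0∞ :=
  (K : ℝ≥0∞)⁻¹ *
    ∑ i : Fin K, ∑' r : α, D r * (if f (Function.update x i r) ≠ f x then 1 else 0)

/-- Given a pair of tables `w`, the function `g_w(z) = f(i ↦ w (z i) i)`. -/
def gTab {α : Type*} {K : ℕ} (f : (Fin K → α) → Bool) (w : Bool → Fin K → α) :
    (Fin K → Bool) → Bool :=
  fun z => f fun i => w (z i) i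

/-- The sensitivity `s^z(g)`: the number of indices `i` with `g z ≠ g (z^{⊕ i})`. -/
def sens {K : ℕ} (g : (Fin K → Bool) → Bool) (z : Fin K → Bool) : ℕ :=
  (Finset.univ.filter fun i : Fin K => g z ≠ g (Function.update z i (!z i))).card

/-- The product of `K` sums over a type is the sum of the products over `Fin K`-tuples. -/
theorem tsum_prod_fin_eq_prod_tsum {α : Type*} :
    ∀ {K : ℕ} (F : Fin K → α → ℝ≥0∞), ∑' y : Fin K → α, ∏ i, F i (y i) = ∏ i, ∑' r, F i r
  | 0, F => by simp
  | K + 1, F => by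
    rw [← (Fin.consEquiv fun _ => α).tsum_eq, ENNReal.tsum_prod', Fin.prod_univ_succ,
      ← tsum_prod_fin_eq_prod_tsum, ← ENNReal.tsum_mul_right]
    refine tsum_congr fun r => ?_
    rw [← ENNReal.tsum_mul_left]
    refine tsum_congr fun y => ?_
    simp [Fin.consEquiv, Fin.prod_univ_succ]

theorem tsum_prod_pmf {α : Type*} {K : ℕ} (D : PMF α) :
    ∑' y : Fin K → α, ∏ i, D (y i) = 1 := by
  simp [tsum_prod_fin_eq_prod_tsum fun _ : Fin K => D, D.tsum_coe]

theorem tsum_prod_pmf_mul_eval {α : Type*} {K : ℕ} (D : PMF α) (i : Fin K) (φ : α → ℝ≥0∞) :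
    ∑' y : Fin K → α, (∏ j, D (y j)) * φ (y i) = ∑' r, D r * φ r := by
  have h := tsum_prod_fin_eq_prod_tsum fun (j : Fin K) r => D r * if j = i then φ r else 1
  simp only [Finset.prod_mul_distrib, Finset.prod_ite_eq', Finset.mem_univ, if_true] at h
  rw [h, Finset.prod_eq_single i]
  · simp
  · intro j _ hj
    simp [hj, D.tsum_coe]
  · simp

/-- The number of coordinates `i` at which replacing `x i` by `y i` changes the value of `f`. -/
noncomputable def blockSens {α : Type*} {K : ℕ} (f : (Fin K → α) → Bool) (x y : Fin K → α) : ℕ :=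
  (Finset.univ.filter fun i : Fin K => f (Function.update x i (y i)) ≠ f x).card

theorem tsum_prod_pmf_mul_blockSens {α : Type*} {K : ℕ} (hK : 1 ≤ K) (D : PMF α)
    (f : (Fin K → α) → Bool) (x : Fin K → α) :
    ∑' y : Fin K → α, (∏ i, D (y i)) * (blockSens f x y : ℝ≥0∞) = K * resampleP D f x := by
  have hK0 : (K : ℝ≥0∞) ≠ 0 := by simp; omega
  rw [resampleP, ← mul_assoc, ENNReal.mul_inv_cancel hK0 (by simp), one_mul]
  simp only [blockSens, Finset.card_filter, Nat.cast_sum, Nat.cast_ite, Nat.cast_one,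
    Nat.cast_zero, Finset.mul_sum]
  rw [Summable.tsum_finsetSum fun _ _ => ENNReal.summable]
  exact Finset.sum_congr rfl fun i _ => tsum_prod_pmf_mul_eval D i
    fun r => if f (Function.update x i r) ≠ f x then 1 else 0

/-- The pair of tables with rows `u.1` (at `true`) and `u.2` (at `false`). -/
def pairTable {β : Type*} (u : β × β) (b : Bool) : β := bif b then u.1 else u.2

/-- Exchange the `i`-th entries of two tables whenever `z i` is `false`. -/
def swapEntries {α : Type*} {K : ℕ} (z : Fin K → Bool) :
    (Fin K → α) × (Fin K → α) ≃ (Fin K → α) × (Fin K → α) :=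
  Function.Involutive.toPerm
    (fun u => (fun i => pairTable u (z i) i, fun i => pairTable u (!z i) i)) (by
      intro u
      ext i <;> cases h : z i <;> simp [pairTable, h])

theorem prod_swapEntries {α : Type*} {K : ℕ} (z : Fin K → Bool) (D : α → ℝ≥0∞)
    (u : (Fin K → α) × (Fin K → α)) :
    (∏ i, D ((swapEntries z u).1 i)) * ∏ i, D ((swapEntries z u).2 i) =
      (∏ i, D (u.1 i)) * ∏ i, D (u.2 i) := by
  rw [← Finset.prod_mul_distrib, ← Finset.prod_mul_distrib]
  refine Finset.prod_congr rfl fun i _ => ?_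
  cases h : z i <;> simp [swapEntries, pairTable, h, mul_comm]

theorem blockSens_swapEntries {α : Type*} {K : ℕ} (f : (Fin K → α) → Bool) (z : Fin K → Bool)
    (u : (Fin K → α) × (Fin K → α)) :
    blockSens f (swapEntries z u).1 (swapEntries z u).2 = sens (gTab f (pairTable u)) z := by
  have h : ∀ i : Fin K, f (Function.update (swapEntries z u).1 i ((swapEntries z u).2 i)) =
      gTab f (pairTable u) (Function.update z i (!z i)) := by
    intro i
    refine congrArg f (funext fun j => ?_)
    by_cases hj : j = i
    · subst hj; simp; rfl
    · simp [hj]; rfl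
  have h₀ : f (swapEntries z u).1 = gTab f (pairTable u) z := rfl
  simp only [blockSens, sens, h, h₀, ne_comm]

/-- A tail bound for the sensitivity of all the functions `gTab f w` bounds the tail of
`blockSens f` on two independent samples. -/
theorem tsum_blockSens_tail_le {α : Type*} {K : ℕ} (f : (Fin K → α) → Bool) (D : PMF α)
    (t : ℝ) (B : ℝ≥0∞)
    (hB : ∀ w : Bool → Fin K → α,
      (∑ z : Fin K → Bool,
        ((2 : ℝ≥0∞) ^ K)⁻¹ * (if t ≤ (sens (gTab f w) z : ℝ) then 1 else 0)) ≤ B) :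
    ∑' u : (Fin K → α) × (Fin K → α), ((∏ i, D (u.1 i)) * ∏ i, D (u.2 i)) *
      (if t ≤ (blockSens f u.1 u.2 : ℝ) then 1 else 0) ≤ B := by
  set S := ∑' u : (Fin K → α) × (Fin K → α), ((∏ i, D (u.1 i)) * ∏ i, D (u.2 i)) *
      (if t ≤ (blockSens f u.1 u.2 : ℝ) then (1 : ℝ≥0∞) else 0) with hS
  have hz : ∀ z : Fin K → Bool, S =
      ∑' u : (Fin K → α) × (Fin K → α), ((∏ i, D (u.1 i)) * ∏ i, D (u.2 i)) *
        (if t ≤ (sens (gTab f (pairTable u)) z : ℝ) then 1 else 0) := by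
    intro z
    rw [hS, ← (swapEntries z).tsum_eq]
    simp only [prod_swapEntries, blockSens_swapEntries]
  have htot : ∑' u : (Fin K → α) × (Fin K → α), (∏ i, D (u.1 i)) * ∏ i, D (u.2 i) = 1 := by
    rw [ENNReal.tsum_prod']
    simp only [ENNReal.tsum_mul_left, tsum_prod_pmf, mul_one]
  calc S = ∑ z : Fin K → Bool, ((2 : ℝ≥0∞) ^ K)⁻¹ * S := by
        rw [Finset.sum_const, nsmul_eq_mul, ← mul_assoc]
        simp [ENNReal.mul_inv_cancel]
    _ = ∑' u : (Fin K → α) × (Fin K → α), ((∏ i, D (u.1 i)) * ∏ i, D (u.2 i)) *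
          ∑ z : Fin K → Bool, ((2 : ℝ≥0∞) ^ K)⁻¹ *
            (if t ≤ (sens (gTab f (pairTable u)) z : ℝ) then 1 else 0) := by
        simp only [Finset.mul_sum]
        rw [Summable.tsum_finsetSum fun _ _ => ENNReal.summable]
        refine Finset.sum_congr rfl fun z _ => ?_
        rw [hz z, ← ENNReal.tsum_mul_left]
        exact tsum_congr fun u => mul_left_comm _ _ _
    _ ≤ ∑' u : (Fin K → α) × (Fin K → α), ((∏ i, D (u.1 i)) * ∏ i, D (u.2 i)) * B :=
        ENNReal.tsum_le_tsum fun u => mul_le_mul_right (hB _) _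
    _ = B := by rw [ENNReal.tsum_mul_right, htot, one_mul]

/-- A reverse Markov inequality: if `f` has large disagreement probability at `x`, then
`blockSens f x y` is large with substantial probability over `y`. -/
theorem half_le_tsum_blockSens_tail {α : Type*} {K : ℕ} (hK : 1 ≤ K) (f : (Fin K → α) → Bool)
    (D : PMF α) {p : ℝ} (hp : 0 < p) {x : Fin K → α}
    (hx : ENNReal.ofReal p ≤ resampleP D f x) :
    ENNReal.ofReal (p / 2) ≤ ∑' y : Fin K → α, (∏ i, D (y i)) *
      (if p * K / 2 ≤ (blockSens f x y : ℝ) then 1 else 0) := by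
  set A := ∑' y : Fin K → α, (∏ i, D (y i)) *
      (if p * K / 2 ≤ (blockSens f x y : ℝ) then (1 : ℝ≥0∞) else 0) with hA
  have hK0 : (K : ℝ≥0∞) ≠ 0 := by simp; omega
  have hpt : ∀ y, (blockSens f x y : ℝ≥0∞) ≤ K * ENNReal.ofReal (p / 2) +
      K * (if p * K / 2 ≤ (blockSens f x y : ℝ) then 1 else 0) := by
    intro y
    split_ifs with h
    · rw [mul_one]
      refine le_add_left ?_
      exact_mod_cast (Finset.card_filter_le _ _).trans (by simp)
    · refine le_add_right ?_
      rw [← ENNReal.ofReal_natCast, ← ENNReal.ofReal_natCast (n := K),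
        ← ENNReal.ofReal_mul (by positivity)]
      exact ENNReal.ofReal_le_ofReal (by linarith)
  have hmean : (K : ℝ≥0∞) * ENNReal.ofReal p ≤ K * (ENNReal.ofReal (p / 2) + A) := by
    calc (K : ℝ≥0∞) * ENNReal.ofReal p ≤ K * resampleP D f x := mul_le_mul_right hx _
      _ = ∑' y : Fin K → α, (∏ i, D (y i)) * (blockSens f x y : ℝ≥0∞) :=
          (tsum_prod_pmf_mul_blockSens hK D f x).symm
      _ ≤ _ := ENNReal.tsum_le_tsum fun y => mul_le_mul_right (hpt y) _
      _ = K * (ENNReal.ofReal (p / 2) + A) := by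
          simp only [mul_add]
          rw [ENNReal.tsum_add, ENNReal.tsum_mul_right, tsum_prod_pmf, one_mul, hA,
            ← ENNReal.tsum_mul_left]
          exact congrArg _ (tsum_congr fun y => mul_left_comm _ _ _)
  have h := (ENNReal.mul_le_mul_iff_right hK0 (by simp)).1 hmean
  rw [← add_halves p, ENNReal.ofReal_add (by positivity) (by positivity), add_halves] at h
  exact (ENNReal.add_le_add_iff_left ENNReal.ofReal_ne_top).1 h

/-- Distributional block-insensitivity: if for every pair of tables `w` the derived functions
`g_w` satisfy the sensitivity tail bound `Pr_z[s^z(g_w) ≥ t] ≤ 2K·2^{-t/c}` (for uniform `z`),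
then `Pr_{x ~ D^K}[p_f(x) ≥ p] ≤ (4K/p)·2^{-pK/(2c)}`. -/
theorem dist_block_insensitivity {α : Type*} {K : ℕ} (hK : 1 ≤ K)
    (f : (Fin K → α) → Bool) (D : PMF α) (c : ℝ) (hc : 0 < c)
    (hsens : ∀ w : Bool → Fin K → α, ∀ t : ℝ, 0 < t →
      (∑ z : Fin K → Bool,
          ((2 : ℝ≥0∞) ^ K)⁻¹ * (if t ≤ (sens (gTab f w) z : ℝ) then 1 else 0)) ≤
        ENNReal.ofReal (2 * K * (2 : ℝ) ^ (-(t / c)))) :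
    ∀ p : ℝ, 0 < p →
      (∑' x : Fin K → α,
          (∏ i, D (x i)) * (if ENNReal.ofReal p ≤ resampleP D f x then 1 else 0)) ≤
        ENNReal.ofReal ((4 * K / p) * (2 : ℝ) ^ (-(p * K / (2 * c)))) := by
  intro p hp
  have hK0 : (0 : ℝ) < K := by exact_mod_cast hK
  have htail := tsum_blockSens_tail_le f D (p * K / 2) _
    fun w => hsens w (p * K / 2) (by positivity)
  rw [ENNReal.tsum_prod'] at htail
  have hmul : (∑' x : Fin K → α, (∏ i, D (x i)) *
      (if ENNReal.ofReal p ≤ resampleP D f x then 1 else 0)) * ENNReal.ofReal (p / 2) ≤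
      ENNReal.ofReal (2 * K * (2 : ℝ) ^ (-(p * K / 2 / c))) := by
    refine le_trans ?_ htail
    rw [← ENNReal.tsum_mul_right]
    refine ENNReal.tsum_le_tsum fun x => ?_
    simp only [mul_assoc, ENNReal.tsum_mul_left]
    refine mul_le_mul_right ?_ _
    split_ifs with hx
    · rw [one_mul]
      exact half_le_tsum_blockSens_tail hK f D hp hx
    · simp
  rw [← ENNReal.le_div_iff_mul_le (Or.inl (by simpa using hp)) (Or.inl ENNReal.ofReal_ne_top),
    ← ENNReal.ofReal_div_of_pos (by positivity)] at hmul
  refine hmul.trans_eq (congrArg _ ?_)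
  rw [div_div]
  field_simp
  norm_num
end

section
/- Let α be a type, N a natural number, μ and ν probability distributions on α, C : (Fin N → α) → Bool, and δ' ≥ 0 a real. Suppose that for every index i ∈ Fin N and every v : Fin N → α, |Pr_{a ~ μ}[C(update v i a) = 1] − Pr_{a ~ ν}[C(update v i a) = 1]| ≤ δ', where update v i a replaces the i-th coordinate of v by a. Then for every probability distribution S on Fin N → Bool, |Pr_{z ~ S, x ~ P_z}[C(x) = 1] − Pr_{x ~ ν^N}[C(x) = 1]| ≤ N · δ'. -/
open scoped ENNReal
open Classical

/-- `Pr_{a ~ μ}[C (update v i a) = 1]`. -/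
noncomputable def updPr {α : Type*} {N : ℕ} (μ : PMF α) (C : (Fin N → α) → Bool)
    (i : Fin N) (v : Fin N → α) : ℝ :=
  (∑' a : α, μ a * (if C (Function.update v i a) = true then 1 else 0)).toReal

/-- `Pr_{z ~ S, x ~ P_z}[C x = 1]`, where the patterned product distribution `P_z` samples
coordinate `i` from `μ` if `z i = true` and from `ν` if `z i = false`, independently. -/
noncomputable def patMixPr {α : Type*} {N : ℕ} (μ ν : PMF α) (S : PMF (Fin N → Bool))
    (C : (Fin N → α) → Bool) : ℝ :=
  (∑ z : Fin N → Bool, S z *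
      ∑' x : Fin N → α,
        (∏ i, if z i then μ (x i) else ν (x i)) * (if C x = true then 1 else 0)).toReal

/-- The expectation of `f` under the product of the distributions `p i`. -/
noncomputable def piExp {α : Type*} {N : ℕ} (p : Fin N → PMF α) (f : (Fin N → α) → ℝ≥0∞) :
    ℝ≥0∞ :=
  ∑' x : Fin N → α, (∏ i, p i (x i)) * f x

theorem piExp_succAbove {α : Type*} {n : ℕ} (p : Fin (n + 1) → PMF α)
    (f : (Fin (n + 1) → α) → ℝ≥0∞) (i : Fin (n + 1)) :
    piExp p f = piExp (fun j => p (i.succAbove j))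
      (fun y => ∑' a, p i a * f (i.insertNth a y)) := by
  unfold piExp
  rw [← (Fin.insertNthEquiv (fun _ => α) i).tsum_eq, ENNReal.tsum_prod', ENNReal.tsum_comm]
  refine tsum_congr fun y => ?_
  rw [← ENNReal.tsum_mul_left]
  refine tsum_congr fun a => ?_
  simp only [Fin.insertNthEquiv_apply, Fin.prod_univ_succAbove _ i, Fin.insertNth_apply_same,
    Fin.insertNth_apply_succAbove]
  rw [mul_assoc, mul_left_comm]
  rfl

theorem piExp_one {α : Type*} {N : ℕ} (p : Fin N → PMF α) : piExp p (fun _ => 1) = 1 := by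
  induction N with
  | zero => simp [piExp]
  | succ n ih => simp [piExp_succAbove p _ 0, PMF.tsum_coe, ih]

theorem piExp_mono {α : Type*} {N : ℕ} (p : Fin N → PMF α) {f g : (Fin N → α) → ℝ≥0∞}
    (h : ∀ x, f x ≤ g x) : piExp p f ≤ piExp p g :=
  ENNReal.tsum_le_tsum fun x => by gcongr; exact h x

theorem piExp_add_const {α : Type*} {N : ℕ} (p : Fin N → PMF α) (f : (Fin N → α) → ℝ≥0∞)
    (c : ℝ≥0∞) : piExp p (fun x => f x + c) = piExp p f + c := by
  have h := piExp_one p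
  simp only [piExp, mul_one] at h
  simp only [piExp, mul_add, ENNReal.tsum_add, ENNReal.tsum_mul_right, h, one_mul]

theorem piExp_ne_top {α : Type*} {N : ℕ} (p : Fin N → PMF α) {f : (Fin N → α) → ℝ≥0∞}
    (hf : ∀ x, f x ≤ 1) : piExp p f ≠ ⊤ :=
  ne_top_of_le_ne_top ENNReal.one_ne_top ((piExp_mono p hf).trans_eq (piExp_one p))

theorem piExp_le_add_of_eq_off {α : Type*} {N : ℕ} {p q : Fin N → PMF α}
    {f : (Fin N → α) → ℝ≥0∞} {c : ℝ≥0∞} (i : Fin N) (hpq : ∀ j, j ≠ i → p j = q j)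
    (h : ∀ v, ∑' a, p i a * f (Function.update v i a) ≤
      ∑' a, q i a * f (Function.update v i a) + c) :
    piExp p f ≤ piExp q f + c := by
  obtain _ | n := N
  · exact i.elim0
  obtain ⟨b, -⟩ := (p i).support_nonempty
  have hoff : (fun j => p (i.succAbove j)) = fun j => q (i.succAbove j) :=
    funext fun j => hpq _ (Fin.succAbove_ne i j)
  rw [piExp_succAbove p f i, piExp_succAbove q f i, hoff, ← piExp_add_const]
  refine piExp_mono _ fun y => ?_
  simpa only [Fin.update_insertNth] using h (i.insertNth b y)

/-- The hybrid argument: replacing the factors of a product distribution one at a time. -/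
theorem piExp_le_add_mul {α : Type*} {N : ℕ} {p q : Fin N → PMF α}
    {f : (Fin N → α) → ℝ≥0∞} {c : ℝ≥0∞}
    (h : ∀ i v, ∑' a, p i a * f (Function.update v i a) ≤
      ∑' a, q i a * f (Function.update v i a) + c) :
    piExp p f ≤ piExp q f + N * c := by
  have hybrid : ∀ s : Finset (Fin N),
      piExp (s.piecewise p q) f ≤ piExp q f + s.card * c := by
    intro s
    induction s using Finset.induction_on with
    | empty => simp
    | insert i s hi ih =>
      have step : piExp ((insert i s).piecewise p q) f ≤ piExp (s.piecewise p q) f + c := by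
        refine piExp_le_add_of_eq_off i (fun j hj => ?_) fun v => ?_
        · simp [Finset.piecewise, hj]
        · simpa [hi] using h i v
      calc _ ≤ _ := step
        _ ≤ piExp q f + s.card * c + c := by gcongr
        _ = _ := by rw [Finset.card_insert_of_notMem hi]; push_cast; ring
  simpa using hybrid Finset.univ

theorem abs_toReal_sub_le {a b : ℝ≥0∞} {d : ℝ} (hd : 0 ≤ d) (ha : a ≠ ⊤) (hb : b ≠ ⊤)
    (hab : a ≤ b + ENNReal.ofReal d) (hba : b ≤ a + ENNReal.ofReal d) :
    |a.toReal - b.toReal| ≤ d := by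
  have h₁ := ENNReal.toReal_le_add hab hb ENNReal.ofReal_ne_top
  have h₂ := ENNReal.toReal_le_add hba ha ENNReal.ofReal_ne_top
  rw [ENNReal.toReal_ofReal hd] at h₁ h₂
  exact abs_sub_le_iff.2 ⟨by linarith, by linarith⟩

theorem le_add_ofReal_of_abs_toReal_sub_le {a b : ℝ≥0∞} {d : ℝ} (ha : a ≠ ⊤) (hb : b ≠ ⊤)
    (h : |a.toReal - b.toReal| ≤ d) : a ≤ b + ENNReal.ofReal d := by
  have hd : 0 ≤ d := (abs_nonneg _).trans h
  rw [← ENNReal.ofReal_toReal ha, ← ENNReal.ofReal_toReal hb,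
    ← ENNReal.ofReal_add ENNReal.toReal_nonneg hd]
  exact ENNReal.ofReal_le_ofReal (by linarith [(abs_sub_le_iff.1 h).1])

theorem PMF.tsum_mul_ne_top {α : Type*} (μ : PMF α) {f : α → ℝ≥0∞} (hf : ∀ a, f a ≤ 1) :
    ∑' a, μ a * f a ≠ ⊤ :=
  ne_top_of_le_ne_top μ.tsum_coe_ne_top <|
    ENNReal.tsum_le_tsum fun a => mul_le_of_le_one_right' (hf a)

/-- Hybrid argument, averaged over a pattern distribution `S`: if resampling any single
coordinate from `μ` rather than `ν` changes the acceptance probability of `C` by at most `δ'`,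
then the acceptance probabilities under `P_S` and under `ν^N` differ by at most `N·δ'`. -/
theorem patMixPr_sub_prod_le {α : Type*} {N : ℕ} (μ ν : PMF α) (C : (Fin N → α) → Bool)
    (δ' : ℝ) (hδ' : 0 ≤ δ')
    (h : ∀ (i : Fin N) (v : Fin N → α), |updPr μ C i v - updPr ν C i v| ≤ δ') :
    ∀ S : PMF (Fin N → Bool),
      |patMixPr μ ν S C -
          (∑' x : Fin N → α, (∏ i, ν (x i)) * (if C x = true then 1 else 0)).toReal| ≤
        N * δ' := by
  intro S
  set f : (Fin N → α) → ℝ≥0∞ := fun x => if C x = true then 1 else 0 with hf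
  have hf1 : ∀ x, f x ≤ 1 := fun x => by simp only [hf]; split_ifs <;> simp
  let p : (Fin N → Bool) → Fin N → PMF α := fun z i => if z i then μ else ν
  let q : Fin N → PMF α := fun _ => ν
  set c := ENNReal.ofReal δ'
  have fin : ∀ (ρ : PMF α) i v, ∑' a, ρ a * f (Function.update v i a) ≠ ⊤ :=
    fun ρ i v => ρ.tsum_mul_ne_top fun a => hf1 _
  have upper : ∀ z, piExp (p z) f ≤ piExp q f + N * c := fun z =>
    piExp_le_add_mul fun i v => by
      by_cases hz : z i
      · simpa [p, q, hz] using
          le_add_ofReal_of_abs_toReal_sub_le (fin μ i v) (fin ν i v) (h i v)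
      · simp [p, q, hz]
  have lower : ∀ z, piExp q f ≤ piExp (p z) f + N * c := fun z =>
    piExp_le_add_mul fun i v => by
      by_cases hz : z i
      · simpa [p, q, hz] using
          le_add_ofReal_of_abs_toReal_sub_le (fin ν i v) (fin μ i v)
            ((abs_sub_comm _ _).trans_le (h i v))
      · simp [p, q, hz]
  have hS : ∑ z, S z = 1 := by rw [← tsum_fintype (L := .unconditional _), S.tsum_coe]
  have hmix : patMixPr μ ν S C = (∑ z, S z * piExp (p z) f).toReal := by
    simp only [patMixPr, piExp, p, hf]
    congr! 7
    split_ifs <;> rfl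
  have hNc : ENNReal.ofReal (N * δ') = N * c := by
    rw [ENNReal.ofReal_mul (Nat.cast_nonneg N), ENNReal.ofReal_natCast]
  rw [hmix]
  change |_ - (piExp q f).toReal| ≤ _
  refine abs_toReal_sub_le (by positivity) ?_ (piExp_ne_top q hf1) ?_ ?_
  · exact ENNReal.sum_ne_top.2 fun z _ =>
      ENNReal.mul_ne_top (S.apply_ne_top z) (piExp_ne_top _ hf1)
  · rw [hNc]
    calc ∑ z, S z * piExp (p z) f ≤ ∑ z, S z * (piExp q f + N * c) := by
          gcongr with z; exact upper z
      _ = _ := by rw [← Finset.sum_mul, hS, one_mul]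
  · rw [hNc]
    calc piExp q f = ∑ z, S z * piExp q f := by rw [← Finset.sum_mul, hS, one_mul]
      _ ≤ ∑ z, S z * (piExp (p z) f + N * c) := by gcongr with z; exact lower z
      _ = _ := by simp only [mul_add, Finset.sum_add_distrib]; rw [← Finset.sum_mul, hS, one_mul]
end

section
/- Let α be a type, N a natural number, μ and ν probability distributions on α, C : (Fin N → α) → Bool, and δ' ≥ 0 a real. Suppose that for every index i ∈ Fin N and every v : Fin N → α, |Pr_{a ~ μ}[C(update v i a) = 1] − Pr_{a ~ ν}[C(update v i a) = 1]| ≤ δ', where update v i a replaces the i-th coordinate of v by a. Then for any two probability distributions S and S' on Fin N → Bool, |Pr_{x ~ P_S}[C(x) = 1] − Pr_{x ~ P_{S'}}[C(x) = 1]| ≤ 2N · δ'. -/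
open scoped ENNReal
open Classical

/-- Summation over `Fin (n + 1) → α` against a product weight, split off at the first coordinate. -/
theorem tsum_prod_mul_fin_succ {α : Type*} {n : ℕ} (p : Fin (n + 1) → α → ℝ≥0∞)
    (f : (Fin (n + 1) → α) → ℝ≥0∞) :
    ∑' x : Fin (n + 1) → α, (∏ i, p i (x i)) * f x =
      ∑' a : α, p 0 a * ∑' y : Fin n → α, (∏ i, p i.succ (y i)) * f (Fin.cons a y) := by
  rw [← (Fin.consEquiv fun _ : Fin (n + 1) => α).tsum_eq, ENNReal.tsum_prod']
  refine tsum_congr fun a => ?_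
  rw [← ENNReal.tsum_mul_left]
  refine tsum_congr fun y => ?_
  simp [Fin.consEquiv, Fin.prod_univ_succ, mul_assoc]

/-- A product of probability mass functions has total mass one. -/
theorem tsum_prod_pmf_eq_one {α : Type*} {n : ℕ} (p : Fin n → PMF α) :
    ∑' x : Fin n → α, ∏ i, p i (x i) = 1 := by
  induction n with
  | zero => simp
  | succ n ih =>
    have key := tsum_prod_mul_fin_succ (fun i => (p i : α → ℝ≥0∞)) fun _ => 1
    simp only [mul_one] at key
    rw [key]
    simp only [ih fun i => p i.succ, mul_one, PMF.tsum_coe]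

/-- Averaging a pointwise bound `f ≤ g + d` against a weight of total mass one. -/
theorem tsum_mul_le_tsum_mul_add {β : Type*} {w f g : β → ℝ≥0∞} {d : ℝ≥0∞}
    (hw : ∑' b, w b = 1) (hfg : ∀ b, f b ≤ g b + d) :
    ∑' b, w b * f b ≤ ∑' b, w b * g b + d :=
  calc ∑' b, w b * f b ≤ ∑' b, (w b * g b + w b * d) :=
        ENNReal.tsum_le_tsum fun b => by rw [← mul_add]; gcongr; exact hfg b
    _ = ∑' b, w b * g b + d := by
        rw [ENNReal.tsum_add, ENNReal.tsum_mul_right, hw, one_mul]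

/-- Hybrid argument: if replacing `p i` by `q i` in any single coordinate costs at most `d`, then
replacing the whole product distribution costs at most `n * d`. -/
theorem tsum_prod_mul_le_add {α : Type*} {n : ℕ} (p q : Fin n → PMF α)
    (f : (Fin n → α) → ℝ≥0∞) (d : ℝ≥0∞)
    (h : ∀ i v, ∑' a, p i a * f (Function.update v i a) ≤
      ∑' a, q i a * f (Function.update v i a) + d) :
    ∑' x : Fin n → α, (∏ i, p i (x i)) * f x ≤
      ∑' x : Fin n → α, (∏ i, q i (x i)) * f x + n * d := by
  induction n with
  | zero => simp
  | succ n ih =>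
    have tail (a : α) := ih (fun i => p i.succ) (fun i => q i.succ) (fun y => f (Fin.cons a y))
      fun i v => by simpa only [Fin.cons_update] using h i.succ (Fin.cons a v)
    have swap (r : PMF α) :
        ∑' a, r a * ∑' y : Fin n → α, (∏ i, q i.succ (y i)) * f (Fin.cons a y) =
          ∑' y : Fin n → α, (∏ i, q i.succ (y i)) * ∑' a, r a * f (Fin.cons a y) := by
      simp only [← ENNReal.tsum_mul_left]
      rw [ENNReal.tsum_comm]
      simp only [mul_left_comm]
    have head (y : Fin n → α) :
        ∑' a, p 0 a * f (Fin.cons a y) ≤ ∑' a, q 0 a * f (Fin.cons a y) + d := by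
      obtain ⟨b⟩ : Nonempty α := ⟨(p 0).support_nonempty.some⟩
      simpa only [Fin.update_cons_zero] using h 0 (Fin.cons b y)
    rw [tsum_prod_mul_fin_succ (fun i => (p i : α → ℝ≥0∞)),
      tsum_prod_mul_fin_succ (fun i => (q i : α → ℝ≥0∞))]
    refine (tsum_mul_le_tsum_mul_add (p 0).tsum_coe tail).trans ?_
    rw [swap, swap]
    refine (add_le_add_left (tsum_mul_le_tsum_mul_add
      (tsum_prod_pmf_eq_one fun i => q i.succ) head) _).trans_eq ?_
    push_cast
    ring

/-- If all values of `A` are within `d` of each other, so are all its averages. -/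
theorem sum_pmf_mul_le_add {β : Type*} [Fintype β] (S S' : PMF β) {A : β → ℝ≥0∞} {d : ℝ≥0∞}
    (hA : ∀ z z', A z ≤ A z' + d) :
    ∑ z, S z * A z ≤ ∑ z, S' z * A z + d := by
  have hconst (T : PMF β) (c : ℝ≥0∞) : ∑' z, T z * c = c := by
    rw [ENNReal.tsum_mul_right, T.tsum_coe, one_mul]
  rw [← tsum_fintype (L := .unconditional β), ← tsum_fintype (L := .unconditional β)]
  have h₁ (z : β) : A z ≤ ∑' z', S' z' * A z' + d := by
    simpa only [hconst] using
      tsum_mul_le_tsum_mul_add (f := fun _ => A z) S'.tsum_coe fun z' => hA z z'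
  exact (ENNReal.tsum_le_tsum fun z => by gcongr; exact h₁ z).trans_eq (hconst S _)

/-- A bound on a difference of `toReal` values gives an additive bound in `ℝ≥0∞`. -/
theorem ENNReal.le_add_ofReal_of_toReal_sub_le {a b : ℝ≥0∞} {d : ℝ} (ha : a ≠ ∞) (hb : b ≠ ∞)
    (hd : 0 ≤ d) (h : a.toReal - b.toReal ≤ d) : a ≤ b + ENNReal.ofReal d := by
  rw [← ENNReal.ofReal_toReal ha, ← ENNReal.ofReal_toReal hb,
    ← ENNReal.ofReal_add ENNReal.toReal_nonneg hd]
  exact ENNReal.ofReal_le_ofReal (by linarith)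

/-- The average of a `[0, 1]`-valued function is finite. -/
theorem tsum_mul_ne_top_of_le_one {β : Type*} {w f : β → ℝ≥0∞} (hw : ∑' b, w b = 1)
    (hf : ∀ b, f b ≤ 1) : ∑' b, w b * f b ≠ ∞ := by
  refine ne_top_of_le_ne_top ENNReal.one_ne_top ?_
  rw [← hw]
  exact ENNReal.tsum_le_tsum fun b => mul_le_of_le_one_right' (hf b)

/-- If resampling any single coordinate from `μ` rather than `ν` changes the acceptance
probability of `C` by at most `δ'`, then for any two pattern distributions `S, S'`, the
acceptance probabilities under `P_S` and `P_{S'}` differ by at most `2N·δ'`. -/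
theorem patMixPr_sub_patMixPr_le {α : Type*} {N : ℕ} (μ ν : PMF α)
    (C : (Fin N → α) → Bool) (δ' : ℝ) (hδ' : 0 ≤ δ')
    (h : ∀ (i : Fin N) (v : Fin N → α), |updPr μ C i v - updPr ν C i v| ≤ δ') :
    ∀ S S' : PMF (Fin N → Bool),
      |patMixPr μ ν S C - patMixPr μ ν S' C| ≤ 2 * N * δ' := by
  let f : (Fin N → α) → ℝ≥0∞ := fun x => if C x = true then 1 else 0
  have hf (x : Fin N → α) : f x ≤ 1 := by
    dsimp only [f]
    split_ifs <;> simp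
  let P : (Fin N → Bool) → Fin N → PMF α := fun z i => if z i then μ else ν
  let A : (Fin N → Bool) → ℝ≥0∞ := fun z => ∑' x : Fin N → α, (∏ i, P z i (x i)) * f x
  have hpat (S : PMF (Fin N → Bool)) : patMixPr μ ν S C = (∑ z, S z * A z).toReal := by
    have hP (z : Fin N → Bool) (i : Fin N) (a : α) :
        P z i a = if z i then μ a else ν a := by
      dsimp only [P]
      split_ifs <;> rfl
    simp only [patMixPr, A, f, hP]
  have hfin (p : PMF α) (i : Fin N) (v : Fin N → α) :
      ∑' a, p a * f (Function.update v i a) ≠ ∞ :=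
    tsum_mul_ne_top_of_le_one p.tsum_coe fun a => hf _
  have hstep (z z' : Fin N → Bool) (i : Fin N) (v : Fin N → α) :
      ∑' a, P z i a * f (Function.update v i a) ≤
        ∑' a, P z' i a * f (Function.update v i a) + ENNReal.ofReal δ' := by
    have hi := abs_le.1 (h i v)
    dsimp only [P]
    refine ENNReal.le_add_ofReal_of_toReal_sub_le (hfin _ i v) (hfin _ i v) hδ' ?_
    change updPr (if z i then μ else ν) C i v - updPr (if z' i then μ else ν) C i v ≤ δ'
    split_ifs <;> linarith
  have hA (z z' : Fin N → Bool) : A z ≤ A z' + N * ENNReal.ofReal δ' :=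
    tsum_prod_mul_le_add (P z) (P z') f _ (hstep z z')
  have hsum_fin (S : PMF (Fin N → Bool)) : ∑ z, S z * A z ≠ ∞ :=
    ENNReal.sum_ne_top.2 fun z _ => ENNReal.mul_ne_top (S.apply_ne_top z)
      (tsum_mul_ne_top_of_le_one (tsum_prod_pmf_eq_one (P z)) hf)
  have hreal (S S' : PMF (Fin N → Bool)) :
      patMixPr μ ν S C ≤ patMixPr μ ν S' C + N * δ' := by
    have hd : (N : ℝ≥0∞) * ENNReal.ofReal δ' ≠ ∞ :=
      ENNReal.mul_ne_top (ENNReal.natCast_ne_top N) ENNReal.ofReal_ne_top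
    have hle := ENNReal.toReal_mono (ENNReal.add_ne_top.2 ⟨hsum_fin S', hd⟩)
      (sum_pmf_mul_le_add S S' hA)
    rwa [ENNReal.toReal_add (hsum_fin S') hd, ENNReal.toReal_mul, ENNReal.toReal_natCast,
      ENNReal.toReal_ofReal hδ', ← hpat, ← hpat] at hle
  intro S S'
  have hN : (0 : ℝ) ≤ N * δ' := by positivity
  rw [abs_le]
  constructor <;> linarith [hreal S S', hreal S' S]
end
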